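/- Let λ₀ := 2 log[ (1/α)·2^{2d+1}·(e + e^{1/2})·(2^α − 1) ]. Then for every λ > λ₀, the probability measure μ_{V_λ}(dx) = C_λ e^{−λ|x|} dx (i.e. V_λ(x) = λ|x| with the normalizing constant C_λ) satisfies the Poincaré inequality: there exists C > 0 such that μ_{V_λ}(f²) ≤ C · 𝓔_{α,V_λ}(f,f) for every f ∈ C_b^∞(ℝ^d) with μ_{V_λ}(f) = 0. -/

import Mathlib

open MeasureTheory Real Set Metric Filter

noncomputable section

/-- Euclidean space `ℝ^d`. -/
abbrev Ed (d : ℕ) := EuclideanSpace ℝ (Fin d)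

/-- The probability measure `μ_V(dx) = C_V e^{-V(x)} dx` with `C_V = (∫ e^{-V})⁻¹`. -/
def muV (d : ℕ) (V : Ed d → ℝ) : Measure (Ed d) :=
  (volume : Measure (Ed d)).withDensity
    fun x => ENNReal.ofReal ((∫ y, Real.exp (-V y))⁻¹ * Real.exp (-V x))

/-- `f ∈ C_b^∞(ℝ^d)`: smooth with bounded derivatives of every order. -/
def CbSmooth (d : ℕ) (f : Ed d → ℝ) : Prop :=
  ContDiff ℝ (⊤ : ℕ∞) f ∧ ∀ n : ℕ, ∃ C : ℝ, ∀ x, ‖iteratedFDeriv ℝ n f x‖ ≤ C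

/-- `V` is locally bounded. -/
def LocallyBounded (d : ℕ) (V : Ed d → ℝ) : Prop :=
  ∀ r : ℝ, ∃ M : ℝ, ∀ x : Ed d, ‖x‖ ≤ r → |V x| ≤ M

/-- The nonlocal Dirichlet form with finite range jumps `𝓔_{α,V}`. -/
def formE (d : ℕ) (α : ℝ) (V f : Ed d → ℝ) : ℝ :=
  (1/2) * ∫ x, (∫ y in {y : Ed d | dist x y ≤ 1},
      (f x - f y) ^ 2 / dist x y ^ ((d : ℝ) + α)) ∂(muV d V)

/-- The nonlocal Dirichlet form with large jumps `𝓓_{α,V}`. -/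
def formD (d : ℕ) (α : ℝ) (V f : Ed d → ℝ) : ℝ :=
  (1/2) * ∫ x, (∫ y in {y : Ed d | 1 < dist x y},
      (f x - f y) ^ 2 / dist x y ^ ((d : ℝ) + α)) ∂(muV d V)

/-- `inf_{z : |x|-1 ≤ |z| ≤ |x|-1/2} e^{-V(z)}`. -/
def infAnn (d : ℕ) (V : Ed d → ℝ) (x : Ed d) : ℝ :=
  sInf ((fun z => Real.exp (-V z)) '' {z : Ed d | ‖x‖ - 1 ≤ ‖z‖ ∧ ‖z‖ ≤ ‖x‖ - 1/2})

/-- `sup_{z : |x| ≤ |z| ≤ |x|+1} e^{-V(z)}`. -/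
def supAnn (d : ℕ) (V : Ed d → ℝ) (x : Ed d) : ℝ :=
  sSup ((fun z => Real.exp (-V z)) '' {z : Ed d | ‖x‖ ≤ ‖z‖ ∧ ‖z‖ ≤ ‖x‖ + 1})

/-- `K(r) = sup_{|x| ≤ r} e^{-V(x)}`. -/
def Kfun (d : ℕ) (V : Ed d → ℝ) (r : ℝ) : ℝ :=
  sSup ((fun x => Real.exp (-V x)) '' {x : Ed d | ‖x‖ ≤ r})

/-- `k(r) = inf_{|x| ≤ r+1} e^{-V(x)}`. -/
def kfun (d : ℕ) (V : Ed d → ℝ) (r : ℝ) : ℝ :=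
  sInf ((fun x => Real.exp (-V x)) '' {x : Ed d | ‖x‖ ≤ r + 1})

/-- The constant `(1/α)·2^{2d+1}·(e + e^{1/2})·(2^α − 1)`. -/
def thresholdConst (d : ℕ) (α : ℝ) : ℝ :=
  (1/α) * (2:ℝ) ^ (2*d+1) * (Real.exp 1 + Real.exp (1/2)) * ((2:ℝ) ^ α - 1)

section
variable {E : Type*} [NormedAddCommGroup E] [NormedSpace ℝ E] [FiniteDimensional ℝ E]
  [MeasurableSpace E] [BorelSpace E] (μ : Measure E) [μ.IsAddHaarMeasure]

theorem lintegral_comp_midpoint (x : E) {h : E → ENNReal} (hh : Measurable h) :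
    ∫⁻ y, h (midpoint ℝ x y) ∂μ = 2 ^ Module.finrank ℝ E * ∫⁻ y, h y ∂μ := by
  have hmid : ∀ y : E, midpoint ℝ x y = (2⁻¹ : ℝ) • (x + y) := fun y => by
    rw [midpoint_eq_smul_add]; simp
  simp_rw [hmid]
  rw [lintegral_add_left_eq_self (fun z => h ((2⁻¹ : ℝ) • z)) x,
    ← lintegral_map hh (measurable_const_smul (2⁻¹ : ℝ)),
    Measure.map_addHaar_smul μ (by norm_num), lintegral_smul_measure, smul_eq_mul]
  congr 1
  rw [inv_pow, inv_inv, abs_of_pos (by positivity), ENNReal.ofReal_pow (by norm_num)]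
  simp
end

/-- The squared increment of `f` between two points of `K` at distance at most `r`,
extended by zero to all pairs of points. -/
noncomputable def localIncrement {E : Type*} [PseudoMetricSpace E] (K : Set E) (r : ℝ)
    (f : E → ℝ) (p : E × E) : ENNReal :=
  {p : E × E | (p.1 ∈ K ∧ p.2 ∈ K) ∧ dist p.1 p.2 ≤ r}.indicator
    (fun p => ENNReal.ofReal ((f p.1 - f p.2) ^ 2)) p

theorem measurable_localIncrement {E : Type*} [PseudoMetricSpace E]
    [SecondCountableTopology E] [MeasurableSpace E] [BorelSpace E] {K : Set E}
    (hK : MeasurableSet K) (r : ℝ) {f : E → ℝ} (hf : Measurable f) :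
    Measurable (localIncrement K r f) := by
  have hm : Measurable fun p : E × E => ENNReal.ofReal ((f p.1 - f p.2) ^ 2) := by fun_prop
  refine hm.indicator ?_
  exact ((hK.preimage measurable_fst).inter (hK.preimage measurable_snd)).inter
    (measurableSet_le measurable_dist measurable_const)

section
variable {E : Type*} [NormedAddCommGroup E] [NormedSpace ℝ E]

theorem localIncrement_two_mul_le {K : Set E} (hK : Convex ℝ K) (r : ℝ) (f : E → ℝ) (x y : E) :
    localIncrement K (2 * r) f (x, y) ≤ 2 * localIncrement K r f (x, midpoint ℝ x y) +
      2 * localIncrement K r f (y, midpoint ℝ y x) := by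
  by_cases h : (x ∈ K ∧ y ∈ K) ∧ dist x y ≤ 2 * r
  · obtain ⟨⟨hx, hy⟩, hr⟩ := h
    have hm : midpoint ℝ x y ∈ K := hK.midpoint_mem hx hy
    have h1 : dist x (midpoint ℝ x y) ≤ r := by
      rw [dist_left_midpoint]; simp; linarith
    have h2 : dist y (midpoint ℝ x y) ≤ r := by
      rw [dist_comm, dist_midpoint_right]; simp; linarith
    rw [midpoint_comm y x]
    simp only [localIncrement, indicator, mem_ofPred_eq, hx, hy, hr, hm, h1, h2, and_self, if_true]
    have h2' : (2 : ENNReal) = ENNReal.ofReal 2 := by simp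
    rw [h2', ← ENNReal.ofReal_mul (by norm_num), ← ENNReal.ofReal_mul (by norm_num),
      ← ENNReal.ofReal_add (by positivity) (by positivity)]
    apply ENNReal.ofReal_le_ofReal
    nlinarith [sq_nonneg ((f x - f (midpoint ℝ x y)) + (f y - f (midpoint ℝ x y)))]
  · simp [localIncrement, indicator, h]

variable [FiniteDimensional ℝ E]
  [MeasurableSpace E] [BorelSpace E] (μ : Measure E) [μ.IsAddHaarMeasure]

theorem lintegral_localIncrement_two_mul_le {K : Set E} (hKc : Convex ℝ K)
    (hK : MeasurableSet K) (r : ℝ) {f : E → ℝ} (hf : Measurable f) :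
    ∫⁻ x, ∫⁻ y, localIncrement K (2 * r) f (x, y) ∂μ ∂μ ≤
      (4 * 2 ^ Module.finrank ℝ E) * ∫⁻ x, ∫⁻ y, localIncrement K r f (x, y) ∂μ ∂μ := by
  have hG : Measurable (localIncrement K r f) := measurable_localIncrement hK r hf
  have hmid : Measurable fun p : E × E => (p.1, midpoint ℝ p.1 p.2) := by
    have : Continuous fun p : E × E => (p.1, midpoint ℝ p.1 p.2) := by
      simp only [midpoint_eq_smul_add]; fun_prop
    exact this.measurable
  have hG1 : Measurable fun p : E × E => localIncrement K r f (p.1, midpoint ℝ p.1 p.2) :=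
    hG.comp hmid
  have hG2 : Measurable fun p : E × E => localIncrement K r f (p.2, midpoint ℝ p.2 p.1) :=
    hG1.comp measurable_swap
  have hint : ∫⁻ x, ∫⁻ y, localIncrement K r f (x, midpoint ℝ x y) ∂μ ∂μ =
      2 ^ Module.finrank ℝ E * ∫⁻ x, ∫⁻ y, localIncrement K r f (x, y) ∂μ ∂μ := by
    rw [← lintegral_const_mul _ (by exact hG.lintegral_prod_right')]
    congr with x
    exact lintegral_comp_midpoint μ x (hG.comp measurable_prodMk_left)
  calc ∫⁻ x, ∫⁻ y, localIncrement K (2 * r) f (x, y) ∂μ ∂μ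
      ≤ ∫⁻ x, ∫⁻ y, (2 * localIncrement K r f (x, midpoint ℝ x y) +
          2 * localIncrement K r f (y, midpoint ℝ y x)) ∂μ ∂μ :=
        lintegral_mono fun x => lintegral_mono fun y => localIncrement_two_mul_le hKc r f x y
    _ = 2 * (∫⁻ x, ∫⁻ y, localIncrement K r f (x, midpoint ℝ x y) ∂μ ∂μ) +
        2 * (∫⁻ x, ∫⁻ y, localIncrement K r f (y, midpoint ℝ y x) ∂μ ∂μ) := by
        rw [← lintegral_const_mul _ (by exact hG1.lintegral_prod_right'),
          ← lintegral_const_mul _ (by exact hG2.lintegral_prod_right'),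
          ← lintegral_add_left (by exact (hG1.lintegral_prod_right').const_mul 2)]
        congr with x
        rw [lintegral_add_left (by exact (hG1.comp measurable_prodMk_left).const_mul 2),
          lintegral_const_mul _ (by exact hG1.comp measurable_prodMk_left),
          lintegral_const_mul _ (by exact hG2.comp measurable_prodMk_left)]
    _ = (4 * 2 ^ Module.finrank ℝ E) * ∫⁻ x, ∫⁻ y, localIncrement K r f (x, y) ∂μ ∂μ := by
        rw [lintegral_lintegral_swap (f := fun x y => localIncrement K r f (y, midpoint ℝ y x))
          hG2.aemeasurable, hint]
        ring

theorem lintegral_localIncrement_pow_le {K : Set E} (hKc : Convex ℝ K)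
    (hK : MeasurableSet K) (r : ℝ) {f : E → ℝ} (hf : Measurable f) (n : ℕ) :
    ∫⁻ x, ∫⁻ y, localIncrement K (2 ^ n * r) f (x, y) ∂μ ∂μ ≤
      (4 * 2 ^ Module.finrank ℝ E) ^ n * ∫⁻ x, ∫⁻ y, localIncrement K r f (x, y) ∂μ ∂μ := by
  induction n with
  | zero => simp
  | succ n ih =>
    rw [pow_succ' 2 n, mul_assoc, pow_succ' _ n, mul_assoc]
    refine (lintegral_localIncrement_two_mul_le μ hKc hK _ hf).trans ?_
    gcongr

/-- A local Poincaré inequality for jumps of length at most one. -/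
theorem exists_lintegral_closedBall_le (R : ℝ) : ∃ C : ENNReal, C ≠ ⊤ ∧ ∀ f : E → ℝ, Measurable f →
    ∫⁻ x in closedBall (0 : E) R, ∫⁻ y in closedBall (0 : E) R,
      ENNReal.ofReal ((f x - f y) ^ 2) ∂μ ∂μ ≤
    C * ∫⁻ x in closedBall (0 : E) R, ∫⁻ y in closedBall x 1,
      ENNReal.ofReal ((f x - f y) ^ 2) ∂μ ∂μ := by
  obtain ⟨n, hn⟩ := pow_unbounded_of_one_lt (2 * R) (one_lt_two (α := ℝ))
  refine ⟨(4 * 2 ^ Module.finrank ℝ E) ^ n, by finiteness, fun f hf => ?_⟩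
  have hK : MeasurableSet (closedBall (0 : E) R) := measurableSet_closedBall
  refine le_trans (le_of_eq ?_) ((lintegral_localIncrement_pow_le μ
    (convex_closedBall (0 : E) R) hK 1 hf n).trans (mul_le_mul_right ?_ _))
  · rw [← lintegral_indicator hK]
    congr with x
    by_cases hx : x ∈ closedBall (0 : E) R
    · rw [indicator_of_mem hx, ← lintegral_indicator hK]
      congr with y
      by_cases hy : y ∈ closedBall (0 : E) R
      · have : dist x y ≤ 2 ^ n * 1 := by
          have := dist_triangle_right x y 0
          rw [mem_closedBall] at hx hy
          linarith
        simp only [localIncrement, indicator, hx, hy, mem_ofPred_eq, this, and_self, if_true]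
      · simp only [localIncrement, indicator, hy, mem_ofPred_eq, and_false, false_and, if_false]
    · simp only [localIncrement, indicator, hx, mem_ofPred_eq, false_and, if_false, lintegral_zero]
  · rw [← lintegral_indicator hK]
    refine lintegral_mono fun x => ?_
    by_cases hx : x ∈ closedBall (0 : E) R
    · rw [indicator_of_mem hx, ← lintegral_indicator measurableSet_closedBall]
      refine lintegral_mono fun y => ?_
      by_cases hy : y ∈ closedBall x 1
      · rw [indicator_of_mem hy]
        exact indicator_le_self _ _ _
      · rw [mem_closedBall, dist_comm] at hy
        simp only [localIncrement, indicator, hy, mem_ofPred_eq, and_false, if_false, zero_le]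
    · simp only [localIncrement, indicator, hx, mem_ofPred_eq, false_and, if_false, lintegral_zero,
        zero_le]
end

section
variable {E : Type*} [NormedAddCommGroup E] [InnerProductSpace ℝ E]

theorem norm_add_le_of_inner {x z : E} (hx : x ≠ 0) (hz : ‖z‖ ≤ 1) :
    ‖x + z‖ ≤ ‖x‖ + inner ℝ (‖x‖⁻¹ • x) z + 1 / (2 * ‖x‖) := by
  have hx' : 0 < ‖x‖ := norm_pos_iff.2 hx
  have h := norm_add_sq_real x z
  rw [real_inner_smul_left]
  have h2 : 2 * ‖x‖ * ‖x + z‖ ≤ 2 * ‖x‖ ^ 2 + 2 * inner ℝ x z + 1 := by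
    nlinarith [sq_nonneg (‖x + z‖ - ‖x‖), norm_nonneg z]
  have : ‖x‖ + ‖x‖⁻¹ * inner ℝ x z + 1 / (2 * ‖x‖) =
      (2 * ‖x‖ ^ 2 + 2 * inner ℝ x z + 1) / (2 * ‖x‖) := by
    field_simp
  rw [this, le_div_iff₀ (by positivity)]
  linarith

variable [FiniteDimensional ℝ E] [MeasurableSpace E] [BorelSpace E] (μ : Measure E)
  [μ.IsAddHaarMeasure]

theorem setIntegral_inner_closedBall (u : E) :
    ∫ z in closedBall (0 : E) 1, inner ℝ u z ∂μ = 0 := by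
  have h : ∫ z in closedBall (0 : E) 1, inner ℝ u (-z) ∂μ =
      ∫ z in closedBall (0 : E) 1, inner ℝ u z ∂μ := by
    rw [← integral_indicator measurableSet_closedBall, ← integral_indicator measurableSet_closedBall,
      ← integral_neg_eq_self _ μ]
    congr with z
    simp [indicator]
  simp only [inner_neg_right, integral_neg] at h
  linarith

theorem add_le_setIntegral_exp_inner {s : ℝ} (hs : 0 < s) {u : E} (hu : ‖u‖ = 1) :
    μ.real (closedBall 0 1) + s ^ 2 / 32 * μ.real (closedBall 0 (1 / 4)) ≤
      ∫ z in closedBall (0 : E) 1, Real.exp (-s * inner ℝ u z) ∂μ := by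
  have hc : IsCompact (closedBall (0 : E) 1) := isCompact_closedBall 0 1
  have i1 : IntegrableOn (fun z => Real.exp (-s * inner ℝ u z)) (closedBall 0 1) μ :=
    (by fun_prop : Continuous fun z : E => Real.exp (-s * inner ℝ u z)).continuousOn.integrableOn_compact hc
  have i2 : IntegrableOn (fun z => -s * inner ℝ u z) (closedBall 0 1) μ :=
    (by fun_prop : Continuous fun z : E => -s * inner ℝ u z).continuousOn.integrableOn_compact hc
  have i3 : IntegrableOn (fun _ : E => (1 : ℝ)) (closedBall 0 1) μ :=
    continuousOn_const.integrableOn_compact hc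
  set c : E := -((1 / 2 : ℝ) • u)
  have hcn : ‖c‖ = 1 / 2 := by simp [c, norm_smul, hu]
  have hsub : closedBall c (1 / 4) ⊆ closedBall 0 1 := by
    intro z hz
    rw [mem_closedBall, dist_eq_norm] at hz
    rw [mem_closedBall_zero_iff]
    have := norm_add_le (z - c) c
    rw [sub_add_cancel] at this
    linarith
  have hexp : ∀ z, 0 ≤ Real.exp (-s * inner ℝ u z) - -s * inner ℝ u z - 1 := fun z => by
    linarith [Real.add_one_le_exp (-s * inner ℝ u z)]
  have i4 := (i1.sub i2).sub i3
  have key : s ^ 2 / 32 * μ.real (closedBall 0 (1 / 4)) ≤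
      ∫ z in closedBall (0 : E) 1, (Real.exp (-s * inner ℝ u z) - -s * inner ℝ u z - 1) ∂μ := by
    calc s ^ 2 / 32 * μ.real (closedBall 0 (1 / 4))
        = ∫ z in closedBall c (1 / 4), s ^ 2 / 32 ∂μ := by
          rw [setIntegral_const, smul_eq_mul, mul_comm, measureReal_def, measureReal_def,
            Measure.addHaar_closedBall_center μ c]
      _ ≤ ∫ z in closedBall c (1 / 4), (Real.exp (-s * inner ℝ u z) - -s * inner ℝ u z - 1) ∂μ := by
          refine setIntegral_mono_on (continuousOn_const.integrableOn_compact
            (isCompact_closedBall _ _)) (i4.mono_set hsub) measurableSet_closedBall fun z hz => ?_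
          have h1 : inner ℝ u z ≤ -(1 / 4) := by
            rw [mem_closedBall, dist_eq_norm] at hz
            have h := real_inner_le_norm u (z - c)
            have h' : inner ℝ u c = -(1 / 2) := by
              simp [c, real_inner_smul_right, hu]
            rw [inner_sub_right, hu, h'] at h
            linarith
          have h2 := Real.quadratic_le_exp_of_nonneg (x := -s * inner ℝ u z) (by nlinarith)
          have h3 : s / 4 ≤ -s * inner ℝ u z := by nlinarith
          nlinarith
      _ ≤ _ := setIntegral_mono_set i4 (ae_of_all _ hexp) hsub.eventuallyLE
  have hsplit : ∫ z in closedBall (0 : E) 1, (Real.exp (-s * inner ℝ u z) - -s * inner ℝ u z - 1) ∂μ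
      = (∫ z in closedBall (0 : E) 1, Real.exp (-s * inner ℝ u z) ∂μ) -
        (∫ z in closedBall (0 : E) 1, -s * inner ℝ u z ∂μ) - ∫ z in closedBall (0 : E) 1, 1 ∂μ := by
    exact (integral_sub (i1.sub i2) i3).trans (congrArg (· - _) (integral_sub i1 i2))
  rw [hsplit, integral_const_mul,
    setIntegral_inner_closedBall, setIntegral_const] at key
  simp only [smul_eq_mul] at key
  linarith

theorem exists_le_setIntegral_exp_neg_norm {s : ℝ} (hs : 0 < s) :
    ∃ R c : ℝ, 0 < c ∧ ∀ x : E, R < ‖x‖ →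
      (μ.real (closedBall 0 1) + c) * Real.exp (-s * ‖x‖) ≤
        ∫ y in closedBall x 1, Real.exp (-s * ‖y‖) ∂μ := by
  set b := μ.real (closedBall (0 : E) 1) with hb
  set c := s ^ 2 / 32 * μ.real (closedBall (0 : E) (1 / 4)) with hc
  have hc0 : 0 < c := by
    have : 0 < μ.real (closedBall (0 : E) (1 / 4)) :=
      ENNReal.toReal_pos (measure_closedBall_pos μ _ (by norm_num)).ne'
        measure_closedBall_lt_top.ne
    positivity
  have hb0 : 0 ≤ b := measureReal_nonneg
  refine ⟨s * (b + c) / c, c / 2, by positivity, fun x hx => ?_⟩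
  have hx0 : 0 < ‖x‖ := lt_of_le_of_lt (by positivity) hx
  have hxne : x ≠ 0 := norm_pos_iff.1 hx0
  have hu : ‖‖x‖⁻¹ • x‖ = 1 := by rw [norm_smul]; simp [hx0.ne']
  have hJ := add_le_setIntegral_exp_inner μ hs hu
  have htr : ∫ y in closedBall x 1, Real.exp (-s * ‖y‖) ∂μ =
      ∫ z in closedBall (0 : E) 1, Real.exp (-s * ‖x + z‖) ∂μ := by
    rw [← integral_indicator measurableSet_closedBall, ← integral_indicator measurableSet_closedBall,
      ← integral_add_left_eq_self _ x]
    congr with z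
    simp [indicator]
  have hcomp : IsCompact (closedBall (0 : E) 1) := isCompact_closedBall 0 1
  have hlow : Real.exp (-s * ‖x‖) * Real.exp (-(s / (2 * ‖x‖))) *
      ∫ z in closedBall (0 : E) 1, Real.exp (-s * inner ℝ (‖x‖⁻¹ • x) z) ∂μ ≤
      ∫ z in closedBall (0 : E) 1, Real.exp (-s * ‖x + z‖) ∂μ := by
    rw [← integral_const_mul]
    refine setIntegral_mono_on ?_ ?_ measurableSet_closedBall fun z hz => ?_
    · exact Continuous.continuousOn (by fun_prop) |>.integrableOn_compact hcomp
    · exact Continuous.continuousOn (by fun_prop) |>.integrableOn_compact hcomp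
    · rw [← Real.exp_add, ← Real.exp_add]
      apply Real.exp_le_exp.2
      have h := norm_add_le_of_inner hxne (mem_closedBall_zero_iff.1 hz)
      have h' := mul_le_mul_of_nonneg_left h hs.le
      have : s / (2 * ‖x‖) = s * (1 / (2 * ‖x‖)) := by ring
      rw [this]
      linarith
  rw [htr]
  refine le_trans ?_ hlow
  rw [mul_comm, mul_assoc]
  refine mul_le_mul_of_nonneg_left ?_ (Real.exp_pos _).le
  refine le_trans ?_ (mul_le_mul_of_nonneg_left hJ (Real.exp_pos _).le)
  have h1 := Real.add_one_le_exp (-(s / (2 * ‖x‖)))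
  refine le_trans ?_ (mul_le_mul_of_nonneg_right h1 (by positivity))
  rw [div_lt_iff₀ hc0] at hx
  have : s / (2 * ‖x‖) * (b + c) ≤ c / 2 := by
    rw [div_mul_eq_mul_div, div_le_iff₀ (by positivity)]
    linarith
  rw [← hb, ← hc]
  linarith
end

theorem setLIntegral_closedBall_eq_lintegral_indicator {E : Type*} [PseudoMetricSpace E]
    [MeasurableSpace E] [OpensMeasurableSpace E] (μ : Measure E) (r : ℝ) (F : E → E → ENNReal)
    (x : E) : ∫⁻ y in closedBall x r, F x y ∂μ =
      ∫⁻ y, {p : E × E | dist p.1 p.2 ≤ r}.indicator (fun p => F p.1 p.2) (x, y) ∂μ := by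
  rw [← lintegral_indicator measurableSet_closedBall]
  congr with y
  simp only [indicator, mem_closedBall, mem_ofPred_eq, dist_comm y x]

section
variable {E : Type*} [PseudoMetricSpace E] [SecondCountableTopology E] [MeasurableSpace E]
  [BorelSpace E] (μ : Measure E) [SFinite μ]

theorem measurable_setLIntegral_closedBall (r : ℝ) {F : E → E → ENNReal}
    (hF : Measurable fun p : E × E => F p.1 p.2) :
    Measurable fun x => ∫⁻ y in closedBall x r, F x y ∂μ := by
  simp_rw [setLIntegral_closedBall_eq_lintegral_indicator μ r F]
  exact (hF.indicator (measurableSet_le measurable_dist measurable_const)).lintegral_prod_right'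

theorem lintegral_setLIntegral_closedBall_swap (r : ℝ) {F : E → E → ENNReal}
    (hF : Measurable fun p : E × E => F p.1 p.2) :
    ∫⁻ x, ∫⁻ y in closedBall x r, F x y ∂μ ∂μ = ∫⁻ x, ∫⁻ y in closedBall x r, F y x ∂μ ∂μ := by
  simp_rw [setLIntegral_closedBall_eq_lintegral_indicator μ r F,
    setLIntegral_closedBall_eq_lintegral_indicator μ r fun x y => F y x]
  rw [lintegral_lintegral_swap]
  · congr with x
    congr with y
    simp only [indicator, mem_ofPred_eq, dist_comm y x]
  · exact (hF.indicator
      (measurableSet_le measurable_dist measurable_const)).aemeasurable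

theorem lintegral_setLIntegral_closedBall_add (r : ℝ) {F G : E → E → ENNReal}
    (hF : Measurable fun p : E × E => F p.1 p.2) :
    ∫⁻ x, ∫⁻ y in closedBall x r, (F x y + G x y) ∂μ ∂μ =
      (∫⁻ x, ∫⁻ y in closedBall x r, F x y ∂μ ∂μ) +
        ∫⁻ x, ∫⁻ y in closedBall x r, G x y ∂μ ∂μ := by
  rw [← lintegral_add_left (measurable_setLIntegral_closedBall μ r hF)]
  congr with x
  exact lintegral_add_left (hF.comp measurable_prodMk_left) _
end

theorem ofReal_mul_add_sq_le {a b : ℝ} (ha : 0 ≤ a) (hb : 0 ≤ b) (u v : ℝ) :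
    ENNReal.ofReal a * ENNReal.ofReal b * ENNReal.ofReal (u ^ 2) +
      ENNReal.ofReal b * ENNReal.ofReal a * ENNReal.ofReal (v ^ 2) ≤
    ENNReal.ofReal a * ENNReal.ofReal b * ENNReal.ofReal ((u - v) ^ 2) +
      (ENNReal.ofReal a ^ 2 * ENNReal.ofReal (u ^ 2) +
        ENNReal.ofReal b ^ 2 * ENNReal.ofReal (v ^ 2)) := by
  simp only [← ENNReal.ofReal_pow, ← ENNReal.ofReal_mul, ha, hb, mul_nonneg, pow_nonneg]
  rw [← ENNReal.ofReal_add (by positivity) (by positivity),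
    ← ENNReal.ofReal_add (by positivity) (by positivity),
    ← ENNReal.ofReal_add (by positivity) (by positivity)]
  apply ENNReal.ofReal_le_ofReal
  nlinarith [sq_nonneg (a * u - b * v)]

section
variable {E : Type*} [NormedAddCommGroup E] [InnerProductSpace ℝ E] [FiniteDimensional ℝ E]
  [MeasurableSpace E] [BorelSpace E] (μ : Measure E) [μ.IsAddHaarMeasure]

/-- A Lyapunov-type estimate: the weighted `L²` norm is controlled by the jump energy and by the
`L²` norm on a fixed ball. -/
theorem exists_lintegral_sq_le_energy_add {s : ℝ} (hs : 0 < s) :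
    ∃ (R : ℝ) (C : ENNReal), C ≠ ⊤ ∧ ∀ g : E → ℝ, Measurable g →
      ∫⁻ x, ENNReal.ofReal (Real.exp (-s * ‖x‖)) ^ 2 * ENNReal.ofReal (g x ^ 2) ∂μ ≠ ⊤ →
      ∫⁻ x, ENNReal.ofReal (Real.exp (-s * ‖x‖)) ^ 2 * ENNReal.ofReal (g x ^ 2) ∂μ ≤
        C * ((∫⁻ x, ENNReal.ofReal (Real.exp (-s * ‖x‖)) ^ 2 *
          ∫⁻ y in closedBall x 1, ENNReal.ofReal ((g x - g y) ^ 2) ∂μ ∂μ) +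
          ∫⁻ x in closedBall 0 R, ENNReal.ofReal (g x ^ 2) ∂μ) := by
  obtain ⟨R, c, hc, hR⟩ := exists_le_setIntegral_exp_neg_norm μ hs
  set p : E → ENNReal := fun x => ENNReal.ofReal (Real.exp (-s * ‖x‖)) with hp
  set B := μ (closedBall (0 : E) 1) with hB
  have hBtop : B ≠ ⊤ := measure_closedBall_lt_top.ne
  set c' := ENNReal.ofReal c with hc'
  have hc'0 : c' ≠ 0 := by simpa [hc'] using hc
  have hc'top : c' ≠ ⊤ := ENNReal.ofReal_ne_top
  have hpm : Measurable p := by fun_prop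
  set L := ENNReal.ofReal (Real.exp s) with hL
  refine ⟨R, (2 * c')⁻¹ * L + (1 + (2 * c')⁻¹ * (2 * B)), ?_, fun g hg hfin => ?_⟩
  · have : (2 * c')⁻¹ ≠ ⊤ := ENNReal.inv_ne_top.2 (mul_ne_zero two_ne_zero hc'0)
    finiteness
  set G : E → ENNReal := fun x => ENNReal.ofReal (g x ^ 2) with hG
  have hGm : Measurable G := by fun_prop
  set 𝓔 := ∫⁻ x, p x ^ 2 * ∫⁻ y in closedBall x 1, ENNReal.ofReal ((g x - g y) ^ 2) ∂μ ∂μ with h𝓔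
  set W := ∫⁻ x, p x ^ 2 * G x ∂μ with hW
  set Wi := ∫⁻ x in closedBall 0 R, p x ^ 2 * G x ∂μ with hWi
  set Wo := ∫⁻ x in (closedBall 0 R)ᶜ, p x ^ 2 * G x ∂μ with hWo
  have hWadd : Wi + Wo = W := lintegral_add_compl _ measurableSet_closedBall
  have hWotop : Wo ≠ ⊤ := ne_top_of_le_ne_top hfin (setLIntegral_le_lintegral _ _)
  have hP : ∀ x, R < ‖x‖ → (B + c') * p x ≤ ∫⁻ y in closedBall x 1, p y ∂μ := by
    intro x hx
    have h := ENNReal.ofReal_le_ofReal (hR x hx)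
    rw [ofReal_integral_eq_lintegral_ofReal _ (ae_of_all _ fun _ => (Real.exp_pos _).le),
      ENNReal.ofReal_mul (by positivity), ENNReal.ofReal_add (by positivity) hc.le,
      ofReal_measureReal hBtop] at h
    · exact h
    · exact (Continuous.continuousOn (by fun_prop)).integrableOn_compact (isCompact_closedBall x 1)
  have hlow : (B + c') * Wo ≤ ∫⁻ x, ∫⁻ y in closedBall x 1, p x * p y * G x ∂μ ∂μ := by
    rw [hWo, ← lintegral_const_mul _ (by fun_prop)]
    refine le_trans ?_ (setLIntegral_le_lintegral (closedBall 0 R)ᶜ _)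
    refine setLIntegral_mono' measurableSet_closedBall.compl fun x hx => ?_
    have hx' : R < ‖x‖ := by simpa using hx
    calc (B + c') * (p x ^ 2 * G x) = p x * G x * ((B + c') * p x) := by ring
      _ ≤ p x * G x * ∫⁻ y in closedBall x 1, p y ∂μ := by gcongr; exact hP x hx'
      _ = ∫⁻ y in closedBall x 1, p x * p y * G x ∂μ := by
        rw [← lintegral_const_mul _ hpm]
        congr with y
        ring
  have hupp : ∫⁻ x, ∫⁻ y in closedBall x 1,
      p x * p y * ENNReal.ofReal ((g x - g y) ^ 2) ∂μ ∂μ ≤ L * 𝓔 := by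
    rw [h𝓔, ← lintegral_const_mul _ (by
      exact (hpm.pow_const 2).mul (measurable_setLIntegral_closedBall μ 1 (by fun_prop)))]
    refine lintegral_mono fun x => ?_
    rw [← mul_assoc, ← lintegral_const_mul _ (by fun_prop)]
    refine setLIntegral_mono' measurableSet_closedBall fun y hy => ?_
    rw [pow_two (p x), ← mul_assoc, mul_comm L, mul_assoc (p x) L]
    gcongr
    simp only [hp, hL]
    rw [← ENNReal.ofReal_mul (Real.exp_pos _).le, ← Real.exp_add]
    apply ENNReal.ofReal_le_ofReal
    apply Real.exp_le_exp.2
    rw [mem_closedBall, dist_comm, dist_eq_norm] at hy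
    have := norm_le_norm_add_norm_sub' x y
    nlinarith
  have hdiag : ∫⁻ x, ∫⁻ _ in closedBall x 1, p x ^ 2 * G x ∂μ ∂μ = B * W := by
    rw [hW, ← lintegral_const_mul _ (by fun_prop)]
    congr with x
    rw [setLIntegral_const, Measure.addHaar_closedBall_center, mul_comm]
  have hmain := lintegral_mono (μ := μ) fun x => lintegral_mono (μ := μ.restrict (closedBall x 1))
    fun y => ofReal_mul_add_sq_le (Real.exp_pos (-s * ‖x‖)).le (Real.exp_pos (-s * ‖y‖)).le
      (g x) (g y)
  rw [lintegral_setLIntegral_closedBall_add μ 1 (by fun_prop),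
    lintegral_setLIntegral_closedBall_add μ 1 (by fun_prop),
    lintegral_setLIntegral_closedBall_add μ 1 (by fun_prop),
    lintegral_setLIntegral_closedBall_swap μ 1 (F := fun x y => ENNReal.ofReal (rexp (-s * ‖y‖)) *
      ENNReal.ofReal (rexp (-s * ‖x‖)) * ENNReal.ofReal (g y ^ 2)) (by fun_prop),
    lintegral_setLIntegral_closedBall_swap μ 1 (F := fun x y => ENNReal.ofReal (rexp (-s * ‖y‖)) ^ 2 *
      ENNReal.ofReal (g y ^ 2)) (by fun_prop)] at hmain
  have hsum : 2 * ((B + c') * Wo) ≤ L * 𝓔 + 2 * (B * W) := by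
    rw [two_mul, two_mul]
    refine (add_le_add hlow hlow).trans (hmain.trans (add_le_add hupp ?_))
    exact (congrArg₂ (· + ·) hdiag hdiag).le
  have hcancel : 2 * c' * Wo ≤ L * 𝓔 + 2 * B * Wi := by
    have hfin' : 2 * B * Wo ≠ ⊤ := by finiteness
    refine (ENNReal.add_le_add_iff_left hfin').1 ?_
    rw [← hWadd] at hsum
    calc 2 * B * Wo + 2 * c' * Wo = 2 * ((B + c') * Wo) := by ring
      _ ≤ _ := hsum
      _ = _ := by ring
  have hWo' : Wo ≤ (2 * c')⁻¹ * (L * 𝓔 + 2 * B * Wi) := by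
    rw [← ENNReal.div_eq_inv_mul, ENNReal.le_div_iff_mul_le (by simp [hc'0])
      (Or.inl (by finiteness)),
      mul_comm]
    exact hcancel
  have hWi' : Wi ≤ ∫⁻ x in closedBall 0 R, G x ∂μ := by
    refine lintegral_mono fun x => mul_le_of_le_one_left' (pow_le_one' ?_ 2)
    rw [hp]
    simp only [ENNReal.ofReal_le_one, Real.exp_le_one_iff]
    nlinarith [norm_nonneg x]
  set I := ∫⁻ x in closedBall 0 R, G x ∂μ
  calc W = Wi + Wo := hWadd.symm
    _ ≤ I + (2 * c')⁻¹ * (L * 𝓔 + 2 * B * I) := by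
      refine add_le_add hWi' (hWo'.trans ?_)
      gcongr
    _ = (2 * c')⁻¹ * L * 𝓔 + (1 + (2 * c')⁻¹ * (2 * B)) * I := by ring
    _ ≤ _ := by
      rw [mul_add]
      exact add_le_add (mul_le_mul_left le_self_add _) (mul_le_mul_left le_add_self _)
/-- The Poincaré inequality for the weight `exp (-2 s ‖x‖)` and the jump kernel `1_{|x - y| ≤ 1}`,
with the centering constant left unspecified. -/
theorem exists_lintegral_sub_sq_le_energy {s : ℝ} (hs : 0 < s) :
    ∃ C : ENNReal, C ≠ ⊤ ∧ ∀ f : E → ℝ, Measurable f →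
      (∀ a, ∫⁻ x, ENNReal.ofReal (Real.exp (-s * ‖x‖)) ^ 2 *
        ENNReal.ofReal ((f x - a) ^ 2) ∂μ ≠ ⊤) →
      ∃ a, ∫⁻ x, ENNReal.ofReal (Real.exp (-s * ‖x‖)) ^ 2 *
        ENNReal.ofReal ((f x - a) ^ 2) ∂μ ≤
        C * ∫⁻ x, ENNReal.ofReal (Real.exp (-s * ‖x‖)) ^ 2 *
          ∫⁻ y in closedBall x 1, ENNReal.ofReal ((f x - f y) ^ 2) ∂μ ∂μ := by
  obtain ⟨R₀, C₁, hC₁, h₁⟩ := exists_lintegral_sq_le_energy_add μ hs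
  set R := max R₀ 1 with hR
  obtain ⟨C₂, hC₂, h₂⟩ := exists_lintegral_closedBall_le μ R
  set K := closedBall (0 : E) R with hKdef
  have hK0 : μ K ≠ 0 := (measure_closedBall_pos μ _ (by positivity)).ne'
  have hKtop : μ K ≠ ⊤ := measure_closedBall_lt_top.ne
  set m := ENNReal.ofReal (Real.exp (-s * R)) ^ 2 with hm
  have hm0 : m ≠ 0 := pow_ne_zero _ (by simpa using Real.exp_pos _)
  have hmtop : m ≠ ⊤ := by finiteness
  refine ⟨C₁ * (1 + (μ K)⁻¹ * (C₂ * m⁻¹)), ?_, fun f hf hfin => ?_⟩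
  · have := ENNReal.inv_ne_top.2 hK0
    have := ENNReal.inv_ne_top.2 hm0
    finiteness
  set 𝓔 := ∫⁻ x, ENNReal.ofReal (Real.exp (-s * ‖x‖)) ^ 2 *
    ∫⁻ y in closedBall x 1, ENNReal.ofReal ((f x - f y) ^ 2) ∂μ ∂μ with h𝓔
  have hlocal : ∫⁻ x in K, ∫⁻ y in closedBall x 1, ENNReal.ofReal ((f x - f y) ^ 2) ∂μ ∂μ ≤
      m⁻¹ * 𝓔 := by
    rw [← ENNReal.div_eq_inv_mul, ENNReal.le_div_iff_mul_le (Or.inl hm0) (Or.inl hmtop), mul_comm,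
      ← lintegral_const_mul _ (measurable_setLIntegral_closedBall μ 1 (by fun_prop))]
    refine (setLIntegral_mono' measurableSet_closedBall fun x hx => ?_).trans
      (setLIntegral_le_lintegral K _)
    rw [mem_closedBall_zero_iff] at hx
    gcongr ?_ ^ 2 * _
    apply ENNReal.ofReal_le_ofReal
    apply Real.exp_le_exp.2
    nlinarith
  obtain ⟨y, -, hy⟩ := exists_le_setLAverage (μ := μ) (s := K)
    (f := fun y => ∫⁻ x in K, ENNReal.ofReal ((f y - f x) ^ 2) ∂μ) hK0 hKtop
    (Measurable.aemeasurable (Measurable.lintegral_prod_right'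
      (f := fun p : E × E => ENNReal.ofReal ((f p.1 - f p.2) ^ 2)) (by fun_prop)))
  rw [setLAverage_eq, ENNReal.div_eq_inv_mul] at hy
  refine ⟨f y, (h₁ (fun x => f x - f y) (by fun_prop) (hfin _)).trans ?_⟩
  simp only [sub_sub_sub_cancel_right]
  rw [← h𝓔, mul_assoc C₁, add_mul, one_mul]
  gcongr C₁ * (𝓔 + ?_)
  calc ∫⁻ x in closedBall 0 R₀, ENNReal.ofReal ((f x - f y) ^ 2) ∂μ
      ≤ ∫⁻ x in K, ENNReal.ofReal ((f x - f y) ^ 2) ∂μ :=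
        lintegral_mono_set (closedBall_subset_closedBall (le_max_left _ _))
    _ = ∫⁻ x in K, ENNReal.ofReal ((f y - f x) ^ 2) ∂μ := by simp only [sub_sq_comm]
    _ ≤ (μ K)⁻¹ * (C₂ * (m⁻¹ * 𝓔)) := hy.trans (by gcongr; exact (h₂ f hf).trans (by gcongr))
    _ = (μ K)⁻¹ * (C₂ * m⁻¹) * 𝓔 := by ring
end

theorem integrable_exp_neg_mul_norm {E : Type*} [NormedAddCommGroup E] [NormedSpace ℝ E]
    [FiniteDimensional ℝ E] [MeasurableSpace E] [BorelSpace E] (μ : Measure E)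
    [μ.IsAddHaarMeasure] {b : ℝ} (hb : 0 < b) : Integrable (fun x : E => Real.exp (-(b * ‖x‖))) μ := by
  rcases subsingleton_or_nontrivial E with h | h
  · have : IsFiniteMeasure μ := isFiniteMeasure_iff μ |>.2 (isCompact_univ.measure_lt_top)
    exact (integrable_const (1 : ℝ)).mono' (by fun_prop) (ae_of_all _ fun x => by
      simp [Real.abs_exp]; positivity)
  rw [integrable_fun_norm_addHaar μ (f := fun r => Real.exp (-(b * r)))]
  have := integrableOn_rpow_mul_exp_neg_mul_rpow (p := 1) (s := ((Module.finrank ℝ E - 1 : ℕ) : ℝ))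
    (b := b) (by have : (0:ℝ) ≤ ((Module.finrank ℝ E - 1 : ℕ) : ℝ) := Nat.cast_nonneg _
                 linarith) one_pos hb
  refine this.congr_fun (fun r _ => ?_) measurableSet_Ioi
  simp

theorem sub_sq_div_rpow_le {E : Type*} [NormedAddCommGroup E] {f : E → ℝ} {L : NNReal} (hf : LipschitzWith L f) (x y : E)
    (γ : ℝ) :
    (f x - f y) ^ 2 / dist x y ^ γ ≤ (L : ℝ) ^ 2 * ‖y - x‖ ^ (-(γ - 2)) := by
  rcases eq_or_ne x y with rfl | hxy
  · simp only [sub_self]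
    rw [zero_pow two_ne_zero, zero_div]
    positivity
  have hd : 0 < dist x y := dist_pos.2 hxy
  have h := hf.dist_le_mul x y
  rw [Real.dist_eq] at h
  rw [← dist_eq_norm, dist_comm y x, div_le_iff₀ (by positivity), mul_assoc, ← Real.rpow_add hd]
  have : -(γ - 2) + γ = (2 : ℕ) := by norm_num
  rw [this, Real.rpow_natCast, ← mul_pow, ← sq_abs]
  gcongr

section
variable {E : Type*} [NormedAddCommGroup E] [NormedSpace ℝ E] [FiniteDimensional ℝ E]
  [MeasurableSpace E] [BorelSpace E] (μ : Measure E) [μ.IsAddHaarMeasure]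

theorem integrableOn_closedBall_rpow_neg_norm (hd : 1 ≤ Module.finrank ℝ E) {β : ℝ}
    (hβ : β < Module.finrank ℝ E) : IntegrableOn (fun z : E => ‖z‖ ^ (-β)) (closedBall 0 1) μ := by
  refine (integrableOn_ball_of_norm_le_rpow (μ := μ) (C := 1) (r := 2) hd hβ
    (ae_of_all _ fun z => ?_) (Measurable.aestronglyMeasurable (by fun_prop))).mono_set
    (closedBall_subset_ball (by norm_num))
  rw [one_mul, Real.norm_of_nonneg (by positivity)]

theorem integrableOn_closedBall_sub_sq_div_rpow (hd : 1 ≤ Module.finrank ℝ E) {γ : ℝ}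
    (hγ : γ < Module.finrank ℝ E + 2) {f : E → ℝ} {L : NNReal} (hf : LipschitzWith L f) (x : E) :
    IntegrableOn (fun y => (f x - f y) ^ 2 / dist x y ^ γ) (closedBall x 1) μ ∧
      ∫ y in closedBall x 1, (f x - f y) ^ 2 / dist x y ^ γ ∂μ ≤
        (L : ℝ) ^ 2 * ∫ z in closedBall (0 : E) 1, ‖z‖ ^ (-(γ - 2)) ∂μ := by
  have hfm := hf.continuous.measurable
  have h0 := (integrableOn_closedBall_rpow_neg_norm μ hd (β := γ - 2) (by linarith)).const_mul
    ((L : ℝ) ^ 2)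
  have hshift : (closedBall x 1).indicator (fun y => (L : ℝ) ^ 2 * ‖y - x‖ ^ (-(γ - 2))) =
      fun y => (closedBall (0 : E) 1).indicator (fun z => (L : ℝ) ^ 2 * ‖z‖ ^ (-(γ - 2))) (y - x) := by
    ext y
    simp [indicator, dist_eq_norm]
  have h1 : IntegrableOn (fun y => (L : ℝ) ^ 2 * ‖y - x‖ ^ (-(γ - 2))) (closedBall x 1) μ := by
    rw [← integrable_indicator_iff measurableSet_closedBall, hshift]
    exact ((integrable_indicator_iff measurableSet_closedBall).2 h0).comp_sub_right x
  have h2 : IntegrableOn (fun y => (f x - f y) ^ 2 / dist x y ^ γ) (closedBall x 1) μ := by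
    refine Integrable.mono' h1 (Measurable.aestronglyMeasurable (by fun_prop))
      (ae_of_all _ fun y => ?_)
    rw [Real.norm_of_nonneg (by positivity)]
    exact sub_sq_div_rpow_le hf x y γ
  refine ⟨h2, (setIntegral_mono h2 h1 fun y => sub_sq_div_rpow_le hf x y γ).trans_eq ?_⟩
  rw [← integral_indicator measurableSet_closedBall, hshift,
    integral_sub_right_eq_self (fun z => (closedBall (0 : E) 1).indicator
      (fun z => (L : ℝ) ^ 2 * ‖z‖ ^ (-(γ - 2))) z) x,
    integral_indicator measurableSet_closedBall, integral_const_mul]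

theorem stronglyMeasurable_setIntegral_closedBall {F : E → E → ℝ}
    (hF : Measurable fun p : E × E => F p.1 p.2) (r : ℝ) :
    StronglyMeasurable fun x => ∫ y in closedBall x r, F x y ∂μ := by
  have h : (fun x => ∫ y in closedBall x r, F x y ∂μ) = fun x => ∫ y,
      {p : E × E | dist p.1 p.2 ≤ r}.indicator (fun p => F p.1 p.2) (x, y) ∂μ := by
    ext x
    rw [← integral_indicator measurableSet_closedBall]
    congr with y
    simp only [indicator, mem_closedBall, mem_ofPred_eq, dist_comm y x]
  rw [h]
  exact StronglyMeasurable.integral_prod_right'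
    (hF.indicator (measurableSet_le measurable_dist measurable_const)).stronglyMeasurable

/-- Dropping the singular part of the kernel only decreases the jump energy. -/
theorem lintegral_sub_sq_le_ofReal_integral (ν : Measure E) [IsFiniteMeasure ν]
    (hd : 1 ≤ Module.finrank ℝ E) {γ : ℝ} (hγ0 : 0 ≤ γ) (hγ : γ < Module.finrank ℝ E + 2)
    {f : E → ℝ} {L : NNReal} (hf : LipschitzWith L f) :
    ∫⁻ x, ∫⁻ y in closedBall x 1, ENNReal.ofReal ((f x - f y) ^ 2) ∂μ ∂ν ≤
      ENNReal.ofReal (∫ x, ∫ y in closedBall x 1, (f x - f y) ^ 2 / dist x y ^ γ ∂μ ∂ν) := by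
  have hfm := hf.continuous.measurable
  have hI := integrableOn_closedBall_sub_sq_div_rpow μ hd hγ hf
  have hnn : ∀ x, 0 ≤ ∫ y in closedBall x 1, (f x - f y) ^ 2 / dist x y ^ γ ∂μ := fun x =>
    integral_nonneg fun y => by positivity
  rw [ofReal_integral_eq_lintegral_ofReal _ (ae_of_all _ hnn)]
  · refine lintegral_mono fun x => ?_
    rw [ofReal_integral_eq_lintegral_ofReal (hI x).1 (ae_of_all _ fun y => by positivity)]
    refine setLIntegral_mono' measurableSet_closedBall fun y hy => ENNReal.ofReal_le_ofReal ?_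
    rcases eq_or_ne x y with rfl | hxy
    · simp
    rw [mem_closedBall, dist_comm] at hy
    have hdist : 0 < dist x y := dist_pos.2 hxy
    exact le_div_self (sq_nonneg _) (by positivity) (Real.rpow_le_one hdist.le hy hγ0)
  · refine (integrable_const ((L : ℝ) ^ 2 * ∫ z in closedBall (0 : E) 1,
      ‖z‖ ^ (-(γ - 2)) ∂μ)).mono' (stronglyMeasurable_setIntegral_closedBall μ
        (F := fun x y => (f x - f y) ^ 2 / dist x y ^ γ) (by fun_prop) 1).aestronglyMeasurable
      (ae_of_all _ fun x => ?_)
    rw [Real.norm_of_nonneg (hnn x)]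
    exact (hI x).2
end

theorem thresholdConst_one_lt (d : ℕ) {α : ℝ} (hα : 0 < α) : 1 < thresholdConst d α := by
  have h1 : 1 / 2 ≤ (1 / α) * ((2 : ℝ) ^ α - 1) := by
    rw [one_div_mul_eq_div, le_div_iff₀ hα, Real.rpow_def_of_pos two_pos]
    nlinarith [Real.add_one_le_exp (Real.log 2 * α), Real.log_two_gt_d9]
  have h2 : (1 : ℝ) ≤ 2 ^ (2 * d) := one_le_pow₀ (by norm_num)
  have h3 : 2 < Real.exp 1 + Real.exp (1 / 2) := by
    linarith [Real.add_one_lt_exp (x := 1) (by norm_num), Real.one_lt_exp_iff.2 (by norm_num : (0 : ℝ) < 1 / 2)]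
  have h4 : thresholdConst d α = 2 ^ (2 * d) * (2 * ((1 / α) * ((2 : ℝ) ^ α - 1))) *
      (Real.exp 1 + Real.exp (1 / 2)) := by
    rw [thresholdConst, pow_succ]
    ring
  have h5 : 1 ≤ (2 : ℝ) ^ (2 * d) * (2 * ((1 / α) * ((2 : ℝ) ^ α - 1))) :=
    one_le_mul_of_one_le_of_one_le h2 (by linarith)
  rw [h4]
  nlinarith

theorem isFiniteMeasure_muV {d : ℕ} {V : Ed d → ℝ} (hV : Integrable fun x => Real.exp (-V x)) :
    IsFiniteMeasure (muV d V) :=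
  isFiniteMeasure_withDensity_ofReal (hV.const_mul _).2

theorem lintegral_muV {d : ℕ} {V : Ed d → ℝ} (hV : Measurable V) {h : Ed d → ENNReal}
    (hh : Measurable h) : ∫⁻ x, h x ∂(muV d V) =
      ENNReal.ofReal (∫ y, Real.exp (-V y))⁻¹ * ∫⁻ x, ENNReal.ofReal (Real.exp (-V x)) * h x := by
  rw [muV, lintegral_withDensity_eq_lintegral_mul _ (by fun_prop) hh,
    ← lintegral_const_mul _ (by fun_prop)]
  congr with x
  rw [Pi.mul_apply, ENNReal.ofReal_mul (inv_nonneg.2 (integral_nonneg fun _ => (Real.exp_pos _).le)),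
    mul_assoc]

theorem CbSmooth.exists_bound {d : ℕ} {f : Ed d → ℝ} (hf : CbSmooth d f) :
    ∃ M, ∀ x, |f x| ≤ M := by
  obtain ⟨M, hM⟩ := hf.2 0
  exact ⟨M, fun x => by simpa using hM x⟩

theorem CbSmooth.exists_lipschitzWith {d : ℕ} {f : Ed d → ℝ} (hf : CbSmooth d f) :
    ∃ L, LipschitzWith L f := by
  obtain ⟨L, hL⟩ := hf.2 1
  refine ⟨L.toNNReal, lipschitzWith_of_nnnorm_fderiv_le (𝕜 := ℝ)
    (hf.1.differentiable (by simp)) fun x => ?_⟩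
  have h := hL x
  rw [norm_iteratedFDeriv_one] at h
  rw [← NNReal.coe_le_coe, coe_nnnorm]
  exact h.trans (Real.le_coe_toNNReal L)

/-- Centering at the mean minimizes the second moment. -/
theorem integral_sq_le_integral_sub_sq {X : Type*} [MeasurableSpace X] {ν : Measure X}
    [IsFiniteMeasure ν] {f : X → ℝ} (hf : MemLp f 2 ν) (h0 : ∫ x, f x ∂ν = 0) (a : ℝ) :
    ∫ x, f x ^ 2 ∂ν ≤ ∫ x, (f x - a) ^ 2 ∂ν := by
  have h1 : Integrable f ν := hf.integrable (by norm_num)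
  have h2 : Integrable (fun x => f x ^ 2) ν := hf.integrable_sq
  have hexp : ∀ x, (f x - a) ^ 2 = f x ^ 2 - 2 * a * f x + a ^ 2 := fun x => by ring
  simp_rw [hexp]
  have h3 : Integrable (fun x => f x ^ 2 - 2 * a * f x) ν := h2.sub (h1.const_mul _)
  rw [integral_add h3 (integrable_const _),
    integral_sub h2 (h1.const_mul _), integral_const_mul, h0, integral_const, smul_eq_mul]
  have : 0 ≤ ν.real univ * a ^ 2 := by positivity
  linarith

theorem formE_eq (d : ℕ) (α : ℝ) (V f : Ed d → ℝ) :
    formE d α V f = (1 / 2) * ∫ x, (∫ y in closedBall x 1,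
      (f x - f y) ^ 2 / dist x y ^ ((d : ℝ) + α)) ∂(muV d V) := by
  simp only [formE, closedBall, dist_comm]

/-- Poincaré inequality for `μ_{V_λ}(dx) = C_λ e^{-λ|x|} dx` whenever
`λ > λ₀ := 2 log[(1/α)·2^{2d+1}·(e+e^{1/2})·(2^α−1)]`. -/
theorem poincare_exponential_measure
    (d : ℕ) (hd : 1 ≤ d) (α : ℝ) (hα : 0 < α ∧ α < 2)
    (lam : ℝ) (hlam : 2 * Real.log (thresholdConst d α) < lam) :
    ∃ C : ℝ, 0 < C ∧ ∀ f : Ed d → ℝ, CbSmooth d f →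
      (∫ x, f x ∂(muV d (fun x => lam * ‖x‖))) = 0 →
      ∫ x, (f x) ^ 2 ∂(muV d (fun x => lam * ‖x‖)) ≤
        C * formE d α (fun x => lam * ‖x‖) f := by
  have hlam0 : 0 < lam :=
    lt_trans (mul_pos two_pos (Real.log_pos (thresholdConst_one_lt d hα.1))) hlam
  set V : Ed d → ℝ := fun x => lam * ‖x‖ with hV
  have hVm : Measurable V := by fun_prop
  have hVint : Integrable (fun x => Real.exp (-V x)) := integrable_exp_neg_mul_norm volume hlam0
  have := isFiniteMeasure_muV hVint
  obtain ⟨C, hC, hCp⟩ := exists_lintegral_sub_sq_le_energy (volume : Measure (Ed d))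
    (half_pos hlam0)
  have hw : ∀ x : Ed d, ENNReal.ofReal (Real.exp (-(lam / 2) * ‖x‖)) ^ 2 =
      ENNReal.ofReal (Real.exp (-V x)) := fun x => by
    rw [← ENNReal.ofReal_pow (Real.exp_pos _).le, ← Real.exp_nat_mul]
    congr 2
    push_cast
    ring
  simp only [hw] at hCp
  refine ⟨2 * C.toReal + 1, by positivity, fun f hf h0 => ?_⟩
  obtain ⟨M, hM⟩ := hf.exists_bound
  obtain ⟨L, hL⟩ := hf.exists_lipschitzWith
  have hfm : Measurable f := hL.continuous.measurable
  have hmem : MemLp f 2 (muV d V) := MemLp.of_bound hfm.aestronglyMeasurable M (ae_of_all _ hM)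
  have hfin : ∀ a, ∫⁻ x, ENNReal.ofReal (Real.exp (-V x)) * ENNReal.ofReal ((f x - a) ^ 2) ≠ ⊤ := by
    intro a
    refine ne_top_of_le_ne_top (b := ∫⁻ x, ENNReal.ofReal (Real.exp (-V x)) *
      ENNReal.ofReal ((M + |a|) ^ 2)) ?_ (lintegral_mono fun x => ?_)
    · rw [lintegral_mul_const _ (by fun_prop)]
      exact ENNReal.mul_ne_top hVint.lintegral_lt_top.ne ENNReal.ofReal_ne_top
    · gcongr ENNReal.ofReal _ * ENNReal.ofReal ?_
      rw [← sq_abs]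
      gcongr
      exact (abs_sub _ _).trans (by gcongr; exact hM x)
  obtain ⟨a, ha⟩ := hCp f hfm hfin
  have henergy := lintegral_sub_sq_le_ofReal_integral volume (muV d V) (γ := d + α)
    (by simpa using hd) (by linarith [hα.1, (Nat.cast_nonneg d : (0 : ℝ) ≤ d)])
    (by simpa using hα.2) hL
  have hmem_sub : MemLp (fun x => f x - a) 2 (muV d V) := hmem.sub (memLp_const a)
  have hE : ∫ x, (∫ y in closedBall x 1, (f x - f y) ^ 2 / dist x y ^ ((d : ℝ) + α)) ∂(muV d V) =
      2 * formE d α V f := by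
    rw [formE_eq]
    ring
  have hE0 : 0 ≤ formE d α V f := by
    rw [formE_eq]
    exact mul_nonneg (by norm_num) (integral_nonneg fun x => integral_nonneg fun y => by positivity)
  rw [hE] at henergy
  have key : ENNReal.ofReal (∫ x, (f x - a) ^ 2 ∂(muV d V)) ≤
      C * ENNReal.ofReal (2 * formE d α V f) := by
    rw [ofReal_integral_eq_lintegral_ofReal hmem_sub.integrable_sq (ae_of_all _ fun _ => sq_nonneg _),
      lintegral_muV hVm (by fun_prop)]
    refine (mul_le_mul_right ha _).trans (le_trans (le_of_eq ?_) (mul_le_mul_right henergy C))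
    rw [lintegral_muV hVm (measurable_setLIntegral_closedBall volume 1 (by fun_prop))]
    ring
  rw [← ENNReal.ofReal_toReal hC, ← ENNReal.ofReal_mul ENNReal.toReal_nonneg,
    ENNReal.ofReal_le_ofReal_iff (by positivity)] at key
  linarith [integral_sq_le_integral_sub_sq hmem h0 a]
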